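/- Let N ≥ 3 be an integer and let σ be a real number with 0 < σ < N−2. Then there exists a constant C > 0 such that for every y ∈ ℝ^N, ∫_{ℝ^N} |y−x|^{−(N−2)} (1+|x|)^{−(2+σ)} dx ≤ C (1+|y|)^{−σ}. -/

import Mathlib

open scoped BigOperators
open MeasureTheory

theorem integrableOn_Ioi_rpow_mul_one_add_rpow {m q : ℝ} (hm : -1 < m) (hq : 0 ≤ q)
    (hmq : m - q < -1) :
    IntegrableOn (fun t : ℝ => t ^ m * (1 + t) ^ (-q)) (Set.Ioi 0) := by
  have hmeas : Measurable fun t : ℝ => t ^ m * (1 + t) ^ (-q) := by fun_prop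
  rw [← Set.Ioc_union_Ioi_eq_Ioi (zero_le_one' ℝ)]
  refine IntegrableOn.union ?_ ?_
  · have h : IntegrableOn (fun t : ℝ => t ^ m) (Set.Ioc 0 1) :=
      (intervalIntegral.intervalIntegrable_rpow' hm).1
    refine Integrable.mono' h hmeas.aestronglyMeasurable ?_
    filter_upwards [ae_restrict_mem measurableSet_Ioc] with t ht
    have ht0 : 0 < t := ht.1
    rw [Real.norm_of_nonneg (by positivity)]
    exact mul_le_of_le_one_right (by positivity)
      (Real.rpow_le_one_of_one_le_of_nonpos (by linarith) (by linarith))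
  · have h := integrableOn_Ioi_rpow_of_lt hmq zero_lt_one
    refine Integrable.mono' h hmeas.aestronglyMeasurable ?_
    filter_upwards [ae_restrict_mem measurableSet_Ioi] with t ht
    have ht0 : 0 < t := zero_lt_one.trans ht
    rw [Real.norm_of_nonneg (by positivity), sub_eq_add_neg, Real.rpow_add ht0]
    exact mul_le_mul_of_nonneg_left
      (Real.rpow_le_rpow_of_nonpos ht0 (by linarith) (by linarith)) (by positivity)

theorem norm_rpow_mul_add_norm_rpow_eq {E : Type*} [NormedAddCommGroup E] [NormedSpace ℝ E]
    {p q s : ℝ} (hs : 0 < s) (z : E) :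
    ‖z‖ ^ (-p) * (s + ‖z‖) ^ (-q) =
      s ^ (-(p + q)) * (‖s⁻¹ • z‖ ^ (-p) * (1 + ‖s⁻¹ • z‖) ^ (-q)) := by
  have hz : ‖z‖ = s * ‖s⁻¹ • z‖ := by
    rw [norm_smul, Real.norm_of_nonneg (by positivity), mul_inv_cancel_left₀ hs.ne']
  have hz' : s + ‖z‖ = s * (1 + ‖s⁻¹ • z‖) := by rw [mul_add, mul_one, ← hz]
  rw [hz', Real.mul_rpow hs.le (by positivity), neg_add, Real.rpow_add hs]
  nth_rewrite 1 [hz]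
  rw [Real.mul_rpow hs.le (by positivity)]
  ring

section RadialKernel

variable {E : Type*} [NormedAddCommGroup E] [NormedSpace ℝ E] [FiniteDimensional ℝ E]
  [MeasurableSpace E] [BorelSpace E] (μ : Measure E) [μ.IsAddHaarMeasure]

theorem integrable_norm_rpow_mul_one_add_norm_rpow [Nontrivial E] {p q : ℝ}
    (hp : p < Module.finrank ℝ E) (hq : 0 ≤ q) (hpq : Module.finrank ℝ E < p + q) :
    Integrable (fun z : E => ‖z‖ ^ (-p) * (1 + ‖z‖) ^ (-q)) μ := by
  refine (integrable_fun_norm_addHaar μ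
    (f := fun t : ℝ => t ^ (-p) * (1 + t) ^ (-q))).2 ?_
  have hd : 1 ≤ Module.finrank ℝ E := Module.finrank_pos
  refine (integrableOn_Ioi_rpow_mul_one_add_rpow (m := Module.finrank ℝ E - 1 - p) (q := q)
    (by linarith) hq (by linarith)).congr_fun (fun t ht => ?_) measurableSet_Ioi
  have ht0 : 0 < t := ht
  simp only [smul_eq_mul]
  rw [← mul_assoc, ← Real.rpow_natCast, ← Real.rpow_add ht0, Nat.cast_sub hd, Nat.cast_one,
    ← sub_eq_add_neg]

theorem integrable_norm_rpow_mul_add_norm_rpow [Nontrivial E] {p q s : ℝ} (hs : 0 < s)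
    (hp : p < Module.finrank ℝ E) (hq : 0 ≤ q) (hpq : Module.finrank ℝ E < p + q) :
    Integrable (fun z : E => ‖z‖ ^ (-p) * (s + ‖z‖) ^ (-q)) μ := by
  simp_rw [norm_rpow_mul_add_norm_rpow_eq hs]
  exact ((integrable_norm_rpow_mul_one_add_norm_rpow μ hp hq hpq).comp_smul
    (inv_ne_zero hs.ne')).const_mul _

theorem integral_norm_rpow_mul_add_norm_rpow {p q s : ℝ} (hs : 0 < s) :
    ∫ z : E, ‖z‖ ^ (-p) * (s + ‖z‖) ^ (-q) ∂μ =
      s ^ (Module.finrank ℝ E - (p + q)) * ∫ z : E, ‖z‖ ^ (-p) * (1 + ‖z‖) ^ (-q) ∂μ := by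
  simp_rw [norm_rpow_mul_add_norm_rpow_eq hs]
  rw [integral_const_mul, Measure.integral_comp_inv_smul_of_nonneg μ
    (fun z : E => ‖z‖ ^ (-p) * (1 + ‖z‖) ^ (-q)) hs.le, smul_eq_mul, ← mul_assoc,
    ← Real.rpow_natCast, ← Real.rpow_add hs]
  congr 2
  ring

end RadialKernel

theorem rpow_neg_le_mul_rpow_neg {u v k r : ℝ} (hk : 0 < k) (hv : 0 < v) (hr : 0 ≤ r)
    (h : v ≤ k * u) : u ^ (-r) ≤ k ^ r * v ^ (-r) := by
  have hu : 0 < u := by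
    by_contra! hu
    nlinarith
  calc u ^ (-r) = k ^ r * (k * u) ^ (-r) := by
        rw [Real.mul_rpow hk.le hu.le, ← mul_assoc, ← Real.rpow_add hk]
        simp
    _ ≤ k ^ r * v ^ (-r) :=
        mul_le_mul_of_nonneg_left (Real.rpow_le_rpow_of_nonpos hv h (by linarith))
          (by positivity)

/-- Away from the origin, the product of the two kernels is dominated by one kernel centred at `y`
and one centred at `0`, both regularized at scale `1 + ‖y‖`. -/
theorem norm_sub_rpow_mul_one_add_norm_rpow_le {E : Type*} [NormedAddCommGroup E] {a b : ℝ}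
    (ha : 0 ≤ a) (hb : 0 ≤ b) (y : E) {x : E} (hx : x ≠ 0) :
    ‖y - x‖ ^ (-a) * (1 + ‖x‖) ^ (-b) ≤
      5 ^ b * (‖y - x‖ ^ (-a) * ((1 + ‖y‖) + ‖y - x‖) ^ (-b)) +
        5 ^ a * (‖x‖ ^ (-b) * ((1 + ‖y‖) + ‖x‖) ^ (-a)) := by
  have hx0 : 0 < ‖x‖ := norm_pos_iff.2 hx
  have hz0 := norm_nonneg (y - x)
  have hy0 := norm_nonneg y
  have htri : ‖y‖ ≤ ‖y - x‖ + ‖x‖ := norm_le_norm_sub_add y x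
  have htri' : ‖y - x‖ ≤ ‖y‖ + ‖x‖ := norm_sub_le y x
  by_cases hcase : (1 + ‖y‖) + ‖y - x‖ ≤ 5 * (1 + ‖x‖)
  · have h := rpow_neg_le_mul_rpow_neg (by norm_num) (by positivity) hb hcase
    refine le_add_of_le_of_nonneg ?_ (by positivity)
    rw [mul_left_comm]
    exact mul_le_mul_of_nonneg_left h (by positivity)
  · have h := rpow_neg_le_mul_rpow_neg (u := ‖y - x‖) (v := (1 + ‖y‖) + ‖x‖) (k := 5)
      (by norm_num) (by positivity) ha (by linarith)
    have h' : (1 + ‖x‖) ^ (-b) ≤ ‖x‖ ^ (-b) :=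
      Real.rpow_le_rpow_of_nonpos hx0 (by linarith) (by linarith)
    refine le_add_of_nonneg_of_le (by positivity) ?_
    calc _ ≤ (5 ^ a * ((1 + ‖y‖) + ‖x‖) ^ (-a)) * ‖x‖ ^ (-b) := by gcongr
      _ = _ := by ring

/-- the convolution-type estimate
`∫ |y-x|^{-(N-2)} (1+|x|)^{-(2+σ)} dx ≤ C (1+|y|)^{-σ}` for `0 < σ < N-2`. -/
theorem stmt_5 (N : ℕ) (hN : 3 ≤ N) (σ : ℝ) (hσ0 : 0 < σ) (hσ : σ < (N : ℝ) - 2) :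
    ∃ C : ℝ, 0 < C ∧ ∀ y : EuclideanSpace ℝ (Fin N),
      (∫ x : EuclideanSpace ℝ (Fin N),
          ‖y - x‖ ^ (-((N : ℝ) - 2)) * (1 + ‖x‖) ^ (-(2 + σ))) ≤
        C * (1 + ‖y‖) ^ (-σ) := by
  have : Nonempty (Fin N) := ⟨⟨0, by omega⟩⟩
  have hdim : Module.finrank ℝ (EuclideanSpace ℝ (Fin N)) = N := finrank_euclideanSpace_fin
  set a : ℝ := (N : ℝ) - 2 with ha
  set b : ℝ := 2 + σ with hb
  have ha0 : 0 ≤ a := by linarith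
  have hb0 : 0 ≤ b := by linarith
  let J (p q : ℝ) : ℝ := ∫ z : EuclideanSpace ℝ (Fin N), ‖z‖ ^ (-p) * (1 + ‖z‖) ^ (-q)
  have hJ (p q : ℝ) : 0 ≤ J p q := integral_nonneg fun z => by positivity
  refine ⟨5 ^ b * J a b + 5 ^ a * J b a + 1, ?_, fun y => ?_⟩
  · have := hJ a b
    have := hJ b a
    positivity
  have hs : 0 < 1 + ‖y‖ := by positivity
  have hia := (integrable_norm_rpow_mul_add_norm_rpow
    (volume : Measure (EuclideanSpace ℝ (Fin N))) hs (p := a) (q := b)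
    (by rw [hdim]; linarith) hb0 (by rw [hdim]; linarith)).comp_sub_left y
  have hib := integrable_norm_rpow_mul_add_norm_rpow
    (volume : Measure (EuclideanSpace ℝ (Fin N))) hs (p := b) (q := a)
    (by rw [hdim]; linarith) ha0 (by rw [hdim]; linarith)
  have hae : ∀ᵐ x : EuclideanSpace ℝ (Fin N), x ≠ 0 := Measure.ae_ne volume 0
  calc _ ≤ ∫ x : EuclideanSpace ℝ (Fin N),
        (5 ^ b * (‖y - x‖ ^ (-a) * ((1 + ‖y‖) + ‖y - x‖) ^ (-b)) +
          5 ^ a * (‖x‖ ^ (-b) * ((1 + ‖y‖) + ‖x‖) ^ (-a))) := by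
        refine integral_mono_of_nonneg (ae_of_all _ fun x => by positivity)
          ((hia.const_mul _).add (hib.const_mul _)) ?_
        filter_upwards [hae] with x hx
        exact norm_sub_rpow_mul_one_add_norm_rpow_le ha0 hb0 y hx
    _ = (5 ^ b * J a b + 5 ^ a * J b a) * (1 + ‖y‖) ^ (-σ) := by
        rw [integral_add (hia.const_mul _) (hib.const_mul _), integral_const_mul,
          integral_const_mul, integral_sub_left_eq_self
            (fun z : EuclideanSpace ℝ (Fin N) => ‖z‖ ^ (-a) * ((1 + ‖y‖) + ‖z‖) ^ (-b)) volume y,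
          integral_norm_rpow_mul_add_norm_rpow volume hs,
          integral_norm_rpow_mul_add_norm_rpow volume hs, hdim,
          show (N : ℝ) - (a + b) = -σ by rw [ha, hb]; ring,
          show (N : ℝ) - (b + a) = -σ by rw [ha, hb]; ring]
        ring
    _ ≤ _ := mul_le_mul_of_nonneg_right (by linarith) (by positivity)
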